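/- Let q, x be complex numbers with |q| < 1. Then Σ_{n=0}^{∞} q^{n²} x^n / (q;q)_n = Σ_{n=0}^{∞} ( q^{n²} x^n / (q²;q²)_n ) · ∏_{k=n+1}^{∞} (1 + x q^{2k}), where all series and products converge absolutely under these hypotheses. -/

import Mathlib

open scoped BigOperators

/-- The finite q-Pochhammer symbol `(a;q)_n = ∏_{i=0}^{n-1} (1 - a q^i)`. -/
noncomputable def qPoch (a q : ℂ) (n : ℕ) : ℂ := ∏ i ∈ Finset.range n, (1 - a * q ^ i)

lemma qPoch_succ (a q : ℂ) (n : ℕ) : qPoch a q (n + 1) = qPoch a q n * (1 - a * q ^ n) :=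
  Finset.prod_range_succ _ _

lemma one_sub_mul_pow_ne_zero {p : ℂ} (hp : ‖p‖ < 1) (n : ℕ) : 1 - p * p ^ n ≠ 0 := by
  intro h
  have h1 : ‖p ^ (n + 1)‖ = 1 := by
    rw [pow_succ', ← sub_eq_zero.mp h, norm_one]
  rw [norm_pow] at h1
  exact (pow_lt_one₀ (norm_nonneg p) hp n.succ_ne_zero).ne h1

lemma qPoch_self_ne_zero {p : ℂ} (hp : ‖p‖ < 1) (n : ℕ) : qPoch p p n ≠ 0 :=
  Finset.prod_ne_zero_iff.mpr fun i _ => one_sub_mul_pow_ne_zero hp i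

lemma norm_sq_lt_one {q : ℂ} (hq : ‖q‖ < 1) : ‖q ^ 2‖ < 1 := by
  rw [norm_pow]
  exact pow_lt_one₀ (norm_nonneg q) hq two_ne_zero

/-- The general term of the series `Σ_n q^{n²} y^n / (p;p)_n`. -/
noncomputable def qTerm (q p y : ℂ) (n : ℕ) : ℂ := q ^ (n ^ 2) * y ^ n / qPoch p p n

lemma qTerm_zero (q p y : ℂ) : qTerm q p y 0 = 1 := by simp [qTerm, qPoch]

lemma qTerm_mul_right (q p y c : ℂ) (n : ℕ) : qTerm q p (y * c) n = qTerm q p y n * c ^ n := by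
  simp only [qTerm, mul_pow]
  ring

lemma qTerm_succ (q : ℂ) {p : ℂ} (hp : ‖p‖ < 1) (y : ℂ) (n : ℕ) :
    qTerm q p y (n + 1) = q ^ (2 * n + 1) * y / (1 - p * p ^ n) * qTerm q p y n := by
  have h1 := one_sub_mul_pow_ne_zero hp n
  have h2 := qPoch_self_ne_zero hp n
  rw [qTerm, qTerm, qPoch_succ]
  field_simp
  ring

lemma summable_norm_qTerm {q p : ℂ} (hq : ‖q‖ < 1) (hp : ‖p‖ < 1) (y : ℂ) :
    Summable fun n => ‖qTerm q p y n‖ := by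
  have hq0 : Filter.Tendsto (fun n : ℕ => q ^ (2 * n + 1)) Filter.atTop (nhds 0) :=
    (tendsto_pow_atTop_nhds_zero_of_norm_lt_one hq).comp
      (Filter.tendsto_atTop_mono (fun n => by simp only [id]; omega) Filter.tendsto_id)
  have hp0 : Filter.Tendsto (fun n : ℕ => 1 - p * p ^ n) Filter.atTop (nhds (1 - p * 0)) :=
    ((tendsto_pow_atTop_nhds_zero_of_norm_lt_one hp).const_mul p).const_sub 1
  have hr : Filter.Tendsto (fun n : ℕ => ‖q ^ (2 * n + 1) * y / (1 - p * p ^ n)‖)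
      Filter.atTop (nhds 0) := by
    simpa using ((hq0.mul_const y).div hp0 (by simp)).norm
  refine summable_of_ratio_norm_eventually_le (r := 1 / 2) (by norm_num) ?_
  filter_upwards [hr.eventually (ge_mem_nhds (show (0 : ℝ) < 1 / 2 by norm_num))] with n hn
  rw [norm_norm, norm_norm, qTerm_succ q hp, norm_mul]
  gcongr

lemma norm_qTerm_mul_pow_le {q : ℂ} (hq : ‖q‖ < 1) (p y : ℂ) (k n : ℕ) :
    ‖qTerm q p (y * q ^ k) n‖ ≤ ‖qTerm q p y n‖ := by
  rw [qTerm_mul_right, norm_mul, ← pow_mul, norm_pow]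
  exact mul_le_of_le_one_right (norm_nonneg _) (pow_le_one₀ (norm_nonneg _) hq.le)

lemma tsum_qTerm_eq_mul {q : ℂ} (hq : ‖q‖ < 1) (y : ℂ) :
    ∑' n, qTerm q (q ^ 2) y n = (1 + y * q) * ∑' n, qTerm q (q ^ 2) (y * q ^ 2) n := by
  have hp := norm_sq_lt_one hq
  have hs (z : ℂ) := (summable_norm_qTerm hq hp z).of_norm
  have hstep (n : ℕ) : qTerm q (q ^ 2) y (n + 1) =
      qTerm q (q ^ 2) (y * q ^ 2) (n + 1) + y * q * qTerm q (q ^ 2) (y * q ^ 2) n := by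
    have h1 := one_sub_mul_pow_ne_zero hp n
    rw [qTerm_mul_right, qTerm_mul_right, qTerm_succ q hp]
    field_simp
    ring
  rw [(hs y).tsum_eq_zero_add, add_mul, one_mul, ← tsum_mul_left]
  conv_rhs => rw [(hs (y * q ^ 2)).tsum_eq_zero_add]
  rw [qTerm_zero, qTerm_zero, tsum_congr hstep,
    ((summable_nat_add_iff 1).mpr (hs _)).tsum_add ((hs _).mul_left _), add_assoc]

lemma tsum_qTerm_eq_prod_mul {q : ℂ} (hq : ‖q‖ < 1) (y : ℂ) (N : ℕ) :
    ∑' n, qTerm q (q ^ 2) y n = (∏ k ∈ Finset.range N, (1 + y * q ^ (2 * k + 1))) *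
      ∑' n, qTerm q (q ^ 2) (y * q ^ (2 * N)) n := by
  induction N with
  | zero => simp
  | succ N ih =>
    rw [ih, tsum_qTerm_eq_mul hq, Finset.prod_range_succ]
    ring_nf

lemma tendsto_tsum_qTerm {q p : ℂ} (hq : ‖q‖ < 1) (hp : ‖p‖ < 1) (y : ℂ) :
    Filter.Tendsto (fun N : ℕ => ∑' n, qTerm q p (y * q ^ (2 * N)) n) Filter.atTop (nhds 1) := by
  have hlim : ∑' n, (if n = 0 then (1 : ℂ) else 0) = 1 := tsum_ite_eq 0 _
  rw [← hlim]
  refine tendsto_tsum_of_dominated_convergence (summable_norm_qTerm hq hp y) (fun n => ?_)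
    (Filter.Eventually.of_forall fun N n => norm_qTerm_mul_pow_le hq p y _ n)
  rcases n with _ | n
  · simp [qTerm_zero]
  · have h := (tendsto_pow_atTop_nhds_zero_of_norm_lt_one (norm_sq_lt_one hq)).pow (n + 1)
    simpa [qTerm_mul_right, pow_mul] using h.const_mul (qTerm q p y (n + 1))

lemma multipliable_one_add_mul_pow {q : ℂ} (hq : ‖q‖ < 1) (y : ℂ) :
    Multipliable fun k : ℕ => 1 + y * q ^ (2 * k + 1) := by
  refine multipliable_one_add_of_summable ?_
  have h := (summable_geometric_of_lt_one (norm_nonneg _) (norm_sq_lt_one hq)).mul_left ‖y * q‖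
  refine h.congr fun k => ?_
  rw [← norm_pow, ← norm_mul]
  ring_nf

/-- Euler's expansion `(-yq;q²)_∞ = Σ_n q^{n²} y^n / (q²;q²)_n`. -/
lemma tprod_one_add_mul_pow_eq_tsum {q : ℂ} (hq : ‖q‖ < 1) (y : ℂ) :
    ∏' k : ℕ, (1 + y * q ^ (2 * k + 1)) = ∑' n, qTerm q (q ^ 2) y n := by
  have h := (multipliable_one_add_mul_pow hq y).hasProd.tendsto_prod_nat.mul
    (tendsto_tsum_qTerm hq (norm_sq_lt_one hq) y)
  simp only [← tsum_qTerm_eq_prod_mul hq y, mul_one] at h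
  exact tendsto_nhds_unique h tendsto_const_nhds

/-- The coefficient identity behind `1 / (z;q)_∞ = 1 / ((z;q²)_∞ (zq;q²)_∞)`. -/
lemma sum_antidiagonal_pow_div_qPoch {q : ℂ} (hq : ‖q‖ < 1) (N : ℕ) :
    ∑ ij ∈ Finset.HasAntidiagonal.antidiagonal N,
      q ^ ij.2 / (qPoch (q ^ 2) (q ^ 2) ij.1 * qPoch (q ^ 2) (q ^ 2) ij.2) =
      1 / qPoch q q N := by
  have hp := norm_sq_lt_one hq
  induction N with
  | zero => simp [qPoch]
  | succ N ih =>
    set a : ℕ → ℂ := qPoch (q ^ 2) (q ^ 2)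
    have hswap : ∑ ij ∈ Finset.HasAntidiagonal.antidiagonal (N + 1), q ^ ij.2 / (a ij.1 * a ij.2) =
        ∑ ij ∈ Finset.HasAntidiagonal.antidiagonal (N + 1), q ^ ij.1 / (a ij.1 * a ij.2) := by
      rw [← Finset.Nat.sum_antidiagonal_swap]
      exact Finset.sum_congr rfl fun ij _ => by simp [mul_comm]
    have hdiff : (1 - q * q ^ N) *
        ∑ ij ∈ Finset.HasAntidiagonal.antidiagonal (N + 1), q ^ ij.2 / (a ij.1 * a ij.2) =
        ∑ ij ∈ Finset.HasAntidiagonal.antidiagonal N, q ^ ij.2 / (a ij.1 * a ij.2) := by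
      rw [sub_mul, one_mul]
      nth_rewrite 2 [hswap]
      rw [Finset.mul_sum, ← Finset.sum_sub_distrib]
      have hterm : ∀ ij ∈ Finset.HasAntidiagonal.antidiagonal (N + 1),
          q ^ ij.2 / (a ij.1 * a ij.2) - q * q ^ N * (q ^ ij.1 / (a ij.1 * a ij.2)) =
            (1 - (q ^ 2) ^ ij.1) * q ^ ij.2 / (a ij.1 * a ij.2) := by
        intro ij hij
        rw [← pow_succ', ← Finset.HasAntidiagonal.mem_antidiagonal.mp hij]
        ring
      rw [Finset.sum_congr rfl hterm, Finset.Nat.sum_antidiagonal_succ]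
      simp only [pow_zero, sub_self, zero_mul, zero_div, zero_add]
      refine Finset.sum_congr rfl fun ij _ => ?_
      have h1 := one_sub_mul_pow_ne_zero hp ij.1
      have h2 : a (ij.1 + 1) = a ij.1 * (1 - q ^ 2 * (q ^ 2) ^ ij.1) := qPoch_succ _ _ _
      rw [h2, pow_succ' (q ^ 2), mul_right_comm, mul_comm (_ - _), mul_div_mul_right _ _ h1]
    rw [ih] at hdiff
    rw [qPoch_succ, ← div_div, ← hdiff, mul_div_cancel_left₀ _ (one_sub_mul_pow_ne_zero hq N)]

lemma sum_antidiagonal_qTerm_mul_qTerm {q : ℂ} (hq : ‖q‖ < 1) (x : ℂ) (N : ℕ) :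
    ∑ ij ∈ Finset.HasAntidiagonal.antidiagonal N,
      qTerm q (q ^ 2) x ij.1 * qTerm q (q ^ 2) (x * q * q ^ (2 * ij.1)) ij.2 = qTerm q q x N := by
  have h : qTerm q q x N = q ^ (N ^ 2) * x ^ N * (1 / qPoch q q N) := by
    rw [qTerm, mul_one_div]
  rw [h, ← sum_antidiagonal_pow_div_qPoch hq, Finset.mul_sum]
  refine Finset.sum_congr rfl fun ij hij => ?_
  rw [← Finset.HasAntidiagonal.mem_antidiagonal.mp hij, qTerm, qTerm, div_mul_div_comm, ← mul_div_assoc]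
  congr 1
  ring

lemma summable_norm_qTerm_mul_qTerm {q : ℂ} (hq : ‖q‖ < 1) (x : ℂ) :
    Summable fun ij : ℕ × ℕ =>
      ‖qTerm q (q ^ 2) x ij.1 * qTerm q (q ^ 2) (x * q * q ^ (2 * ij.1)) ij.2‖ := by
  have hs (z : ℂ) := summable_norm_qTerm hq (norm_sq_lt_one hq) z
  refine Summable.of_nonneg_of_le (fun _ => norm_nonneg _) (fun ij => ?_)
    ((hs x).mul_of_nonneg (hs (x * q)) (fun _ => norm_nonneg _) fun _ => norm_nonneg _)
  rw [norm_mul]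
  exact mul_le_mul_of_nonneg_left (norm_qTerm_mul_pow_le hq _ _ _ _) (norm_nonneg _)

/-- Ramanujan's identity, equivalent form: for `|q| < 1`,
`Σ_n q^{n²} x^n / (q;q)_n = Σ_n (q^{n²} x^n / (q²;q²)_n) (−xq^{2n+2};q²)_∞`,
with all series and products converging absolutely. -/
theorem stmt3 (q x : ℂ) (hq : ‖q‖ < 1) :
    Summable (fun n : ℕ => ‖q ^ (n ^ 2) * x ^ n / qPoch q q n‖) ∧
    (∀ n : ℕ, Multipliable (fun k : ℕ => 1 + x * q ^ (2 * (n + 1 + k)))) ∧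
    Summable (fun n : ℕ =>
      ‖q ^ (n ^ 2) * x ^ n / qPoch (q ^ 2) (q ^ 2) n *
        ∏' k : ℕ, (1 + x * q ^ (2 * (n + 1 + k)))‖) ∧
    ∑' n : ℕ, q ^ (n ^ 2) * x ^ n / qPoch q q n
      = ∑' n : ℕ, q ^ (n ^ 2) * x ^ n / qPoch (q ^ 2) (q ^ 2) n *
          ∏' k : ℕ, (1 + x * q ^ (2 * (n + 1 + k))) := by
  have hfactor (n k : ℕ) : 1 + x * q ^ (2 * (n + 1 + k)) =
      1 + x * q * q ^ (2 * n) * q ^ (2 * k + 1) := by ring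
  have hprod (n : ℕ) : ∏' k : ℕ, (1 + x * q ^ (2 * (n + 1 + k))) =
      ∑' m, qTerm q (q ^ 2) (x * q * q ^ (2 * n)) m := by
    simp only [hfactor, tprod_one_add_mul_pow_eq_tsum hq]
  have hs := summable_norm_qTerm_mul_qTerm hq x
  have hterm (n : ℕ) : q ^ (n ^ 2) * x ^ n / qPoch (q ^ 2) (q ^ 2) n *
        ∏' k : ℕ, (1 + x * q ^ (2 * (n + 1 + k))) =
      ∑' m, qTerm q (q ^ 2) x n * qTerm q (q ^ 2) (x * q * q ^ (2 * n)) m := by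
    rw [hprod, tsum_mul_left, qTerm]
  refine ⟨summable_norm_qTerm hq hq x, fun n => ?_, ?_, ?_⟩
  · simp only [hfactor]
    exact multipliable_one_add_mul_pow hq _
  · simp only [hterm]
    exact Summable.of_nonneg_of_le (fun _ => norm_nonneg _)
      (fun n => norm_tsum_le_tsum_norm (hs.prod_factor n)) hs.prod
  · simp only [hterm]
    have hsigma := Finset.HasAntidiagonal.sigmaAntidiagonalEquivProd.summable_iff.mpr hs.of_norm
    simp only [Function.comp_def] at hsigma
    rw [← hs.of_norm.tsum_prod, ← Finset.HasAntidiagonal.sigmaAntidiagonalEquivProd.tsum_eq,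
      hsigma.tsum_sigma' fun N => (hasSum_fintype _).summable]
    refine tsum_congr fun N => ?_
    rw [tsum_fintype]
    exact (sum_antidiagonal_qTerm_mul_qTerm hq x N).symm.trans (Finset.sum_coe_sort _ _).symm
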